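/- Let G be a finite simple graph and U ⊆ V(G) a set of vertices with the property that for every independent set σ of the induced subgraph G[U] (including σ = ∅), the total reduced rational Betti number of I(G \ (U ∪ N[σ])) is at most B. Then β̃(I(G)) ≤ B · |I(G[U])| ≤ B · 2^{|U|}. Moreover, for the partition of the vertices of I(G) into U and W = V(G) \ U, one has lk_W σ = I(G \ (U ∪ N[σ])) for every σ ∈ I(G[U]). -/

import Mathlib

attribute [local instance] Classical.propDecidable

noncomputable section

open Finset Module
open scoped DirectSum

universe u

/-- An abstract simplicial complex on vertex type `V`, encoded by its set of faces
(finite subsets of `V`), required to be downward closed and to contain the empty face.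
(The complex with only the empty face is the "empty complex", i.e. `S^{-1}`.) -/
structure SComplex (V : Type u) where
  faces : Set (Finset V)
  empty_mem : ∅ ∈ faces
  down_closed : ∀ {s t : Finset V}, s ∈ faces → t ⊆ s → t ∈ faces

namespace SComplex

variable {V : Type u}

/-- Ordered `j`-simplices of `K`: tuples of `j` vertices (repetitions allowed) spanning a
face of `K`.  Chains on these compute the reduced homology of `K` (this is the augmented,
unnormalized chain complex of the simplicial set associated to `K`); the level `j`
corresponds to reduced degree `j - 1`. -/
def OSimplex (K : SComplex V) (j : ℕ) : Type u :=
  {t : Fin j → V // Finset.univ.image t ∈ K.faces}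

/-- The `ℚ`-vector space of (level `j`, i.e. reduced degree `j-1`) simplicial chains. -/
abbrev Chain (K : SComplex V) (j : ℕ) : Type u := OSimplex K j →₀ ℚ

/-- The basis chain corresponding to a single ordered simplex. -/
def ofSimplex (K : SComplex V) (j : ℕ) (s : OSimplex K j) : Chain K j :=
  Finsupp.single s 1

/-- Boundary of a single ordered simplex: the alternating sum of its facets. -/
def bdryO (K : SComplex V) (j : ℕ) (s : OSimplex K (j + 1)) : Chain K j :=
  ∑ i : Fin (j + 1), Finsupp.single
    ⟨s.1 ∘ i.succAbove, K.down_closed s.2 (by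
      intro v hv
      simp only [Finset.mem_image] at hv ⊢
      obtain ⟨w, -, rfl⟩ := hv
      exact ⟨i.succAbove w, Finset.mem_univ _, rfl⟩)⟩
    ((-1 : ℚ) ^ (i : ℕ))

/-- The simplicial boundary map (from level `j+1` to level `j`). -/
def bdry (K : SComplex V) (j : ℕ) : Chain K (j + 1) →ₗ[ℚ] Chain K j :=
  Finsupp.lsum ℚ fun s => LinearMap.toSpanSingleton ℚ (Chain K j) (bdryO K j s)

/-- Cycles at level `j` (reduced degree `j - 1`).  At level `0` (spanned by the empty
simplex) every chain is a cycle: this is the augmented complex. -/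
def cyclesAt (K : SComplex V) : (j : ℕ) → Submodule ℚ (Chain K j)
  | 0 => ⊤
  | j + 1 => LinearMap.ker (bdry K j)

/-- Boundaries at level `j`. -/
def boundariesAt (K : SComplex V) (j : ℕ) : Submodule ℚ (Chain K j) :=
  LinearMap.range (bdry K j)

/-- Reduced simplicial homology with rational coefficients:
`homologyAt K j` is the reduced homology group `H̃_{j-1}(K; ℚ)`
(so `homologyAt K 0 = H̃_{-1}`, `homologyAt K (i+1) = H̃_i`). -/
abbrev homologyAt (K : SComplex V) (j : ℕ) : Type u :=
  cyclesAt K j ⧸ ((boundariesAt K j).comap (cyclesAt K j).subtype)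

/-- The homology class of a cycle. -/
def hClass (K : SComplex V) (j : ℕ) (z : Chain K j) (hz : z ∈ cyclesAt K j) :
    homologyAt K j :=
  Submodule.Quotient.mk ⟨z, hz⟩

/-- The reduced Betti number `β̃_{j-1}(K) = dim_ℚ H̃_{j-1}(K; ℚ)`. -/
def bettiAt (K : SComplex V) (j : ℕ) : ℕ := finrank ℚ (homologyAt K j)

/-- The total reduced Betti number `β̃(K) = ∑_i β̃_i(K)` (including degree `-1`). -/
def totalBetti (K : SComplex V) : ℕ := finrank ℚ (⨁ j : ℕ, homologyAt K j)

/-- Simplicial cochains with rational coefficients. -/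
abbrev Cochain (K : SComplex V) (j : ℕ) : Type u := Chain K j →ₗ[ℚ] ℚ

/-- The simplicial coboundary map, the transpose of the boundary. -/
def cobdry (K : SComplex V) (j : ℕ) : Cochain K j →ₗ[ℚ] Cochain K (j + 1) :=
  (bdry K j).dualMap

/-- Cocycles at level `j` (reduced degree `j-1`). -/
def cocyclesAt (K : SComplex V) (j : ℕ) : Submodule ℚ (Cochain K j) :=
  LinearMap.ker (cobdry K j)

/-- Coboundaries at level `j`. -/
def cobordsAt (K : SComplex V) : (j : ℕ) → Submodule ℚ (Cochain K j)
  | 0 => ⊥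
  | j + 1 => LinearMap.range (cobdry K j)

/-- Reduced simplicial cohomology with rational coefficients:
`cohomologyAt K j` is `H̃^{j-1}(K; ℚ)`. -/
abbrev cohomologyAt (K : SComplex V) (j : ℕ) : Type u :=
  cocyclesAt K j ⧸ ((cobordsAt K j).comap (cocyclesAt K j).subtype)

/-- The cohomology class of a cocycle. -/
def hcClass (K : SComplex V) (j : ℕ) (γ : Cochain K j) (hγ : γ ∈ cocyclesAt K j) :
    cohomologyAt K j :=
  Submodule.Quotient.mk ⟨γ, hγ⟩

/-- Evaluation of a cocycle on homology classes. -/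
def pairingAux (K : SComplex V) (j : ℕ) (γ : cocyclesAt K j) :
    homologyAt K j →ₗ[ℚ] ℚ :=
  Submodule.liftQ _ ((γ : Cochain K j).comp (cyclesAt K j).subtype) (by
    rintro ⟨z, hz⟩ hmem
    simp only [Submodule.mem_comap, Submodule.subtype_apply] at hmem
    obtain ⟨x, hx⟩ := hmem
    simp only [LinearMap.mem_ker, LinearMap.comp_apply, Submodule.subtype_apply]
    have hker : cobdry K j (γ : Cochain K j) = 0 := γ.2
    have h2 : (cobdry K j (γ : Cochain K j)) x = 0 := by rw [hker]; rfl
    calc (γ : Cochain K j) z = (γ : Cochain K j) (bdry K j x) := by rw [hx]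
      _ = (cobdry K j (γ : Cochain K j)) x := rfl
      _ = 0 := h2)

/-- The evaluation pairing `⟨·,·⟩ : H̃^{j-1}(K;ℚ) ⊗ H̃_{j-1}(K;ℚ) → ℚ`
given by evaluating cochains on chains. -/
def pairing (K : SComplex V) (j : ℕ) :
    cohomologyAt K j →ₗ[ℚ] homologyAt K j →ₗ[ℚ] ℚ :=
  Submodule.liftQ _
    { toFun := fun γ => pairingAux K j γ
      map_add' := by
        intro γ δ
        apply LinearMap.ext
        intro x
        obtain ⟨⟨z, hz⟩, rfl⟩ := Submodule.Quotient.mk_surjective _ x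
        simp [pairingAux, Submodule.liftQ_apply]
      map_smul' := by
        intro c γ
        apply LinearMap.ext
        intro x
        obtain ⟨⟨z, hz⟩, rfl⟩ := Submodule.Quotient.mk_surjective _ x
        simp [pairingAux, Submodule.liftQ_apply] }
    (by
      rintro ⟨γ, hγ⟩ hmem
      simp only [Submodule.mem_comap, Submodule.subtype_apply] at hmem
      simp only [LinearMap.mem_ker]
      apply LinearMap.ext
      intro x
      obtain ⟨⟨z, hz⟩, rfl⟩ := Submodule.Quotient.mk_surjective _ x
      simp only [LinearMap.coe_mk, AddHom.coe_mk, LinearMap.zero_apply]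
      cases j with
      | zero =>
          have : γ = 0 := by simpa [cobordsAt] using hmem
          simp [pairingAux, Submodule.liftQ_apply, this]
      | succ j =>
          obtain ⟨η, hη⟩ := hmem
          have hz0 : bdry K j z = 0 := hz
          simp only [pairingAux, Submodule.liftQ_apply]
          calc γ.comp (cyclesAt K (j+1)).subtype ⟨z, hz⟩ = γ z := rfl
            _ = (cobdry K j η) z := by rw [hη]
            _ = η (bdry K j z) := rfl
            _ = 0 := by rw [hz0]; exact map_zero η)

end SComplex
section Graphs

open SComplex

variable {V : Type u}

/-- The independence complex `I(G)` of a graph `G`: faces are the independent sets. -/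
def indepComplex (G : SimpleGraph V) : SComplex V where
  faces := {s : Finset V | ∀ v ∈ s, ∀ w ∈ s, ¬ G.Adj v w}
  empty_mem := by simp
  down_closed := by
    intro s t hs hts v hv w hw
    exact hs v (hts hv) w (hts hw)

/-- `s` is an independent set of the graph `G`. -/
def IsIndepSet (G : SimpleGraph V) (s : Finset V) : Prop :=
  ∀ v ∈ s, ∀ w ∈ s, ¬ G.Adj v w

/-- `σ` is a dominating set of `G`: every vertex is in the closed neighbourhood `N[σ]`. -/
def IsDominating (G : SimpleGraph V) (σ : Finset V) : Prop :=
  ∀ v : V, ∃ w ∈ σ, w = v ∨ G.Adj w v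

/-- The closed neighbourhood `N[σ]` of a finite set of vertices. -/
def closedNbhd (G : SimpleGraph V) (σ : Finset V) : Set V :=
  {v | ∃ w ∈ σ, w = v ∨ G.Adj w v}

/-- An induced matching of size `k` in `G`: `k` edges `(fst i, snd i)` such that
any two vertices belonging to distinct edges are distinct and non-adjacent. -/
structure InducedMatching (G : SimpleGraph V) (k : ℕ) where
  fst : Fin k → V
  snd : Fin k → V
  adj : ∀ i, G.Adj (fst i) (snd i)
  disjoint : ∀ i j, i ≠ j → fst i ≠ fst j ∧ fst i ≠ snd j ∧ snd i ≠ fst j ∧ snd i ≠ snd j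
  induced : ∀ i j, i ≠ j → ¬ G.Adj (fst i) (fst j) ∧ ¬ G.Adj (fst i) (snd j) ∧
    ¬ G.Adj (snd i) (fst j) ∧ ¬ G.Adj (snd i) (snd j)

namespace InducedMatching

variable {G : SimpleGraph V} {k : ℕ}

/-- The set of vertices covered by the matching. -/
def vertexFinset (M : InducedMatching G k) : Finset V :=
  Finset.univ.image M.fst ∪ Finset.univ.image M.snd

/-- A transversal of a matching: a set of vertices of the matching containing exactly one
vertex from each edge. -/
def IsTransversal (M : InducedMatching G k) (σ : Finset V) : Prop :=
  σ ⊆ M.vertexFinset ∧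
    ∀ i, (M.fst i ∈ σ ∧ M.snd i ∉ σ) ∨ (M.snd i ∈ σ ∧ M.fst i ∉ σ)

/-- The chain `([v_1] - [w_1]) ∧ ⋯ ∧ ([v_k] - [w_k])` representing the image `α_M` of the
fundamental class of the sphere `I(M) = S^{k-1}` in `I(G)`. -/
def matchingChain (M : InducedMatching G k) : Chain (indepComplex G) k :=
  ∑ c : Fin k → Bool,
    ((-1 : ℚ) ^ (Finset.univ.filter (fun i => c i = true)).card) •
      Finsupp.single
        ⟨fun i => if c i then M.snd i else M.fst i, by
          intro v hv w hw
          simp only [Finset.mem_image, Finset.mem_univ, true_and] at hv hw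
          obtain ⟨i, rfl⟩ := hv
          obtain ⟨j, rfl⟩ := hw
          by_cases hij : i = j
          · subst hij
            by_cases h : c i <;> simp [h, SimpleGraph.irrefl]
          · obtain ⟨h1, h2, h3, h4⟩ := M.induced i j hij
            by_cases hi : c i <;> by_cases hj : c j <;> simp [hi, hj, h1, h2, h3, h4]⟩
        1

end InducedMatching

namespace SComplex

/-- The coefficient of the cochain `σ^∨` on an ordered simplex: `±1` (the sign of the
corresponding permutation) on the orderings of `σ` and `0` on all other simplices. -/
def dualCoeff (K : SComplex V) (k : ℕ) (σ : Finset V) (s : OSimplex K k) : ℚ :=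
  if h : Function.Injective s.1 ∧ Finset.univ.image s.1 = σ then
    have hcard : Fintype.card {x // x ∈ σ} = k := by
      rw [Fintype.card_coe, ← h.2, Finset.card_image_of_injective _ h.1]
      simp
    ((Equiv.Perm.sign
      ((Equiv.ofBijective
          (fun i : Fin k => (⟨s.1 i, by
            rw [← h.2]; exact Finset.mem_image_of_mem _ (Finset.mem_univ i)⟩ : {x // x ∈ σ}))
          (by
            rw [Fintype.bijective_iff_injective_and_card]
            exact ⟨fun a b hab => h.1 (congrArg Subtype.val hab), by simp [hcard]⟩)).trans
        (Fintype.equivFinOfCardEq hcard)) : ℤ) : ℚ)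
  else 0

/-- The cochain `σ^∨` associated to an independent set `σ` of cardinality `k`: it assigns
`±1` to the two orientations of `σ` and `0` to all other simplices.  When `σ` is a maximal
independent set this cochain is a cocycle. -/
def dualCochain (K : SComplex V) (k : ℕ) (σ : Finset V) : Cochain K k :=
  Finsupp.linearCombination ℚ (dualCoeff K k σ)

end SComplex

end Graphs
section Topology

open SComplex

variable {V : Type u}

/-- The geometric realization of a simplicial complex on a finite vertex set: the space of
convex weightings of the vertices whose support is a face.  (The realization of the empty
complex, which has only the empty face, is the empty space `S^{-1}`.) -/
def realization [Fintype V] (K : SComplex V) : Type u :=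
  {f : V → ℝ // (∀ v, 0 ≤ f v) ∧ (∑ v, f v) = 1 ∧
    Finset.univ.filter (fun v => f v ≠ 0) ∈ K.faces}

instance realizationTopology [Fintype V] (K : SComplex V) :
    TopologicalSpace (realization K) := by
  unfold realization; infer_instance

/-- The induced subcomplex `K[U]` of `K` on a vertex subset `U` (kept on the ambient
vertex type). -/
def inducedSub (K : SComplex V) (U : Set V) : SComplex V where
  faces := {s | s ∈ K.faces ∧ ∀ v ∈ s, v ∈ U}
  empty_mem := ⟨K.empty_mem, by simp⟩
  down_closed := by
    rintro s t ⟨hs, hsU⟩ hts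
    exact ⟨K.down_closed hs hts, fun v hv => hsU v (hts hv)⟩

/-- The continuous inclusion of the realization of a subcomplex. -/
def inclMap [Fintype V] {K L : SComplex V} (h : K.faces ⊆ L.faces) :
    C(realization K, realization L) :=
  ⟨fun p => ⟨p.1, p.2.1, p.2.2.1, h p.2.2.2⟩,
    Continuous.subtype_mk continuous_subtype_val _⟩

/-- The relation generated by gluing in a mapping cone: the base of the cylinder is glued
along `f` and the top of the cylinder is collapsed to a point. -/
inductive coneRel {A X : Type u} (f : A → X) :
    (A × unitInterval) ⊕ X → (A × unitInterval) ⊕ X → Prop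
  | base (a : A) : coneRel f (Sum.inl (a, 0)) (Sum.inr (f a))
  | tip (a b : A) : coneRel f (Sum.inl (a, 1)) (Sum.inl (b, 1))

/-- The mapping cone (homotopy cofibre) `C(f)` of a continuous map `f : A → X`. -/
def MappingCone {A X : Type u} [TopologicalSpace A] [TopologicalSpace X]
    (f : C(A, X)) : Type u :=
  Quot (coneRel f.toFun)

instance mappingConeTopology {A X : Type u} [TopologicalSpace A] [TopologicalSpace X]
    (f : C(A, X)) : TopologicalSpace (MappingCone f) := by
  unfold MappingCone; infer_instance

/-- The wedge sum `X ∨ Y` of two pointed spaces. -/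
def Wedge2 (X Y : Type u) [TopologicalSpace X] [TopologicalSpace Y]
    (x0 : X) (y0 : Y) : Type u :=
  Quot (fun p q : X ⊕ Y => p = Sum.inl x0 ∧ q = Sum.inr y0)

instance wedge2Topology (X Y : Type u) [TopologicalSpace X] [TopologicalSpace Y]
    (x0 : X) (y0 : Y) : TopologicalSpace (Wedge2 X Y x0 y0) := by
  unfold Wedge2; infer_instance

/-- The wedge sum `⋁_i X_i` of a family of pointed spaces. -/
def PtdWedge {ι : Type u} (X : ι → Type u) [∀ i, TopologicalSpace (X i)]
    (pt : ∀ i, X i) : Type u :=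
  Quot (fun p q : (Σ i, X i) => (∃ i, p = ⟨i, pt i⟩) ∧ (∃ j, q = ⟨j, pt j⟩))

instance ptdWedgeTopology {ι : Type u} (X : ι → Type u) [∀ i, TopologicalSpace (X i)]
    (pt : ∀ i, X i) : TopologicalSpace (PtdWedge X pt) := by
  unfold PtdWedge; infer_instance

/-- The relation generating the unreduced suspension (as the join with `S^0`, so that the
suspension of the empty space is `S^0`): the two cone points are the two extra points. -/
inductive suspRel (X : Type u) : (X × unitInterval) ⊕ Bool → (X × unitInterval) ⊕ Bool → Prop
  | bot (x : X) : suspRel X (Sum.inl (x, 0)) (Sum.inr false)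
  | top (x : X) : suspRel X (Sum.inl (x, 1)) (Sum.inr true)

/-- Unreduced suspension `Σ X` (with the join convention `Σ ∅ = S^0`). -/
def Susp (X : Type u) : Type u := Quot (suspRel X)

instance suspTopology (X : Type u) [TopologicalSpace X] : TopologicalSpace (Susp X) := by
  unfold Susp; infer_instance

/-- Iterated suspension `Σ^n X`. -/
def IterSusp : ℕ → Type u → Type u
  | 0, X => X
  | n + 1, X => Susp (IterSusp n X)

instance iterSuspTopology : ∀ (n : ℕ) (X : Type u) [TopologicalSpace X],
    TopologicalSpace (IterSusp n X)
  | 0, _, i => i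
  | n + 1, X, i => @suspTopology _ (@iterSuspTopology n X i)

/-- The quotient space `X / A` obtained by collapsing a subset `A` to a point. -/
def QuotBy (X : Type u) [TopologicalSpace X] (A : Set X) : Type u :=
  Quot (fun p q : X => p ∈ A ∧ q ∈ A)

instance quotByTopology (X : Type u) [TopologicalSpace X] (A : Set X) :
    TopologicalSpace (QuotBy X A) := by
  unfold QuotBy; infer_instance

end Topology
namespace SComplex

variable {V : Type u}

/-- The faces of the induced subcomplex `K[U]`; its cardinality (`Set.ncard`, counting
the empty face) is the quantity `|K[U]|`. -/
def facesIn (K : SComplex V) (U : Set V) : Set (Finset V) :=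
  {s | s ∈ K.faces ∧ ∀ v ∈ s, v ∈ U}

/-- For a vertex partition `V = U ⊔ W` (`W = Uᶜ`) and a face `σ` of `K[U]`, the
subcomplex `lk_W σ` of `K[W]`: the faces `τ ⊆ W` with `τ ⊔ σ ∈ K`. -/
def lkW (K : SComplex V) (U : Set V) (σ : Finset V) (hσ : σ ∈ K.faces) : SComplex V where
  faces := {τ | (∀ v ∈ τ, v ∉ U) ∧ τ ∪ σ ∈ K.faces}
  empty_mem := ⟨by simp, by simpa using hσ⟩
  down_closed := by
    rintro s t ⟨hs1, hs2⟩ hts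
    exact ⟨fun v hv => hs1 v (hts hv),
      K.down_closed hs2 (Finset.union_subset_union hts le_rfl)⟩

/-- For a vertex partition `V = U ⊔ W` and a face `σ` of `K[U]`, the subcomplex
`st_W σ = (lk_W σ) ∗ σ` of `K`: the faces `τ ∈ K` with `τ ∩ U ⊆ σ` and
`τ ∩ W ∈ lk_W σ`. -/
def stW (K : SComplex V) (U : Set V) (σ : Finset V) (hσ : σ ∈ K.faces) : SComplex V where
  faces := {τ | τ ∈ K.faces ∧ (∀ v ∈ τ, v ∈ U → v ∈ σ) ∧
    (τ.filter (fun v => v ∉ U)) ∪ σ ∈ K.faces}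
  empty_mem := ⟨K.empty_mem, by simp, by simpa using hσ⟩
  down_closed := by
    rintro s t ⟨hs1, hs2, hs3⟩ hts
    refine ⟨K.down_closed hs1 hts, fun v hv hvU => hs2 v (hts hv) hvU,
      K.down_closed hs3 ?_⟩
    exact Finset.union_subset_union (Finset.filter_subset_filter _ hts) le_rfl

end SComplex
namespace HomAux

variable {V : Type u}

abbrev AA (V : Type u) (j : ℕ) : Type u := (Fin j → V) →₀ ℚ

def dO (j : ℕ) (t : Fin (j + 1) → V) : AA V j :=
  ∑ i : Fin (j + 1), Finsupp.single (t ∘ i.succAbove) ((-1 : ℚ) ^ (i : ℕ))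

def dd (j : ℕ) : AA V (j + 1) →ₗ[ℚ] AA V j :=
  Finsupp.lsum ℚ fun s => LinearMap.toSpanSingleton ℚ (AA V j) (dO j s)

def pre (x : V) (j : ℕ) : AA V j →ₗ[ℚ] AA V (j + 1) :=
  Finsupp.lmapDomain ℚ ℚ (fun t => (Fin.cons x t : Fin (j + 1) → V))

def prj (v : V) (j : ℕ) : AA V j →ₗ[ℚ] AA V j where
  toFun := Finsupp.filter (fun t => v ∈ Finset.univ.image t)
  map_add' := fun _ _ => Finsupp.filter_add
  map_smul' := fun _ _ => Finsupp.filter_smul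

lemma dd_single (j : ℕ) (t : Fin (j + 1) → V) (c : ℚ) :
    dd j (Finsupp.single t c) = c • dO j t := by
  simp [dd]

lemma dd_pre_single (x : V) (j : ℕ) (t : Fin (j + 1) → V) :
    dd (j + 1) (pre x (j + 1) (Finsupp.single t 1)) =
      Finsupp.single t 1 - pre x j (dd j (Finsupp.single t 1)) := by
  simp only [pre, Finsupp.lmapDomain_apply, Finsupp.mapDomain_single, dd_single, one_smul, dO]
  rw [Fin.sum_univ_succ]
  have h0 : (Fin.cons x t : Fin (j + 2) → V) ∘ (Fin.succAbove 0) = t := by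
    ext i; simp
  rw [h0, Finsupp.mapDomain_finsetSum, sub_eq_add_neg, ← Finset.sum_neg_distrib]
  simp only [Fin.val_zero, pow_zero]
  congr 1
  refine Finset.sum_congr rfl fun i _ => ?_
  rw [Fin.cons_comp_succ_succAbove, Finsupp.mapDomain_single, ← Finsupp.single_neg]
  simp [pow_succ]
  rfl

lemma dd_pre (x : V) (j : ℕ) (c : AA V (j + 1)) :
    dd (j + 1) (pre x (j + 1) c) = c - pre x j (dd j c) := by
  have : (dd (j + 1)).comp (pre x (j + 1)) = LinearMap.id - (pre x j).comp (dd j) := by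
    refine Finsupp.lhom_ext' fun t => LinearMap.ext_ring ?_
    simpa using dd_pre_single x j t
  exact LinearMap.congr_fun this c

lemma dd_pre_zero (x : V) (c : AA V 0) :
    dd 0 (pre x 0 c) = c := by
  have : (dd 0).comp (pre x 0) = LinearMap.id := by
    refine Finsupp.lhom_ext' fun t => LinearMap.ext_ring ?_
    simp only [LinearMap.comp_apply, Finsupp.lsingle_apply, pre, Finsupp.lmapDomain_apply,
      Finsupp.mapDomain_single, dd_single, one_smul, dO, LinearMap.id_apply]
    rw [Fin.sum_univ_succ]
    simp
  exact LinearMap.congr_fun this c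

lemma dd_dd (j : ℕ) (c : AA V (j + 2)) : dd j (dd (j + 1) c) = 0 := by
  revert c
  suffices key : (dd j).comp (dd (V := V) (j + 1)) = 0 from fun c => LinearMap.congr_fun key c
  induction j with
  | zero =>
    refine Finsupp.lhom_ext' fun t => LinearMap.ext_ring ?_
    have : Finsupp.single t (1:ℚ) = pre (t 0) 1 (Finsupp.single (Fin.tail t) 1) := by
      simp [pre]
    simp only [LinearMap.comp_apply, Finsupp.lsingle_apply]
    rw [this, dd_pre, map_sub, dd_pre_zero]
    simp
  | succ j ih =>
    refine Finsupp.lhom_ext' fun t => LinearMap.ext_ring ?_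
    have : Finsupp.single t (1:ℚ) = pre (t 0) (j + 2) (Finsupp.single (Fin.tail t) 1) := by
      simp [pre]
    simp only [LinearMap.comp_apply, Finsupp.lsingle_apply]
    rw [this, dd_pre, map_sub, dd_pre]
    have := LinearMap.congr_fun (ih) (Finsupp.single (Fin.tail t) 1)
    simp only [LinearMap.comp_apply] at this
    rw [this]
    simp

def SS (F : Set (Finset V)) (j : ℕ) : Submodule ℚ (AA V j) :=
  Finsupp.supported ℚ ℚ {t | Finset.univ.image t ∈ F}

lemma SS_mono {F F' : Set (Finset V)} (h : F ⊆ F') (j : ℕ) : SS F j ≤ SS F' j :=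
  Finsupp.supported_mono fun _ ht => h ht

lemma SS_inter {F F' : Set (Finset V)} {j : ℕ} {c : AA V j} (h : c ∈ SS F j) (h' : c ∈ SS F' j) :
    c ∈ SS (F ∩ F') j := by
  rw [SS, Finsupp.mem_supported] at *
  exact fun t ht => ⟨h ht, h' ht⟩

lemma dd_mem {F : Set (Finset V)} (hF : ∀ s ∈ F, ∀ t ⊆ s, t ∈ F) {j : ℕ} {c : AA V (j + 1)}
    (hc : c ∈ SS F (j + 1)) : dd j c ∈ SS F j := by
  rw [SS, Finsupp.supported_eq_span_single] at hc
  induction hc using Submodule.span_induction with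
  | mem x hx =>
    obtain ⟨t, ht, rfl⟩ := hx
    simp only [dd_single, one_smul, dO]
    refine Submodule.sum_mem _ fun i _ => Finsupp.single_mem_supported _ _ ?_
    refine hF _ ht _ ?_
    intro v hv
    simp only [Finset.mem_image] at hv ⊢
    obtain ⟨w, -, rfl⟩ := hv
    exact ⟨i.succAbove w, Finset.mem_univ _, rfl⟩
  | zero => simp
  | add x y _ _ hx hy => rw [map_add]; exact add_mem hx hy
  | smul a x _ hx => rw [map_smul]; exact Submodule.smul_mem _ _ hx

lemma pre_mem {F F' : Set (Finset V)} (v : V) (h : ∀ s ∈ F, insert v s ∈ F') {j : ℕ} {c : AA V j}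
    (hc : c ∈ SS F j) : pre v j c ∈ SS F' (j + 1) := by
  rw [SS, Finsupp.supported_eq_span_single] at hc
  induction hc using Submodule.span_induction with
  | mem x hx =>
    obtain ⟨t, ht, rfl⟩ := hx
    simp only [pre, Finsupp.lmapDomain_apply, Finsupp.mapDomain_single]
    refine Finsupp.single_mem_supported _ _ ?_
    have : Finset.univ.image (Fin.cons v t : Fin (j + 1) → V) = insert v (Finset.univ.image t) := by
      ext w
      simp [Fin.exists_fin_succ, eq_comm]
    simp only [Set.mem_ofPred_eq]
    rw [this]
    exact h _ ht
  | zero => simp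
  | add x y _ _ hx hy => rw [map_add]; exact add_mem hx hy
  | smul a x _ hx => rw [map_smul]; exact Submodule.smul_mem _ _ hx

lemma prj_mem {F : Set (Finset V)} (v : V) {j : ℕ} {c : AA V j} (hc : c ∈ SS F j) :
    prj v j c ∈ SS (F ∩ {s | v ∈ s}) j := by
  rw [SS, Finsupp.mem_supported] at *
  intro t ht
  simp only [prj, LinearMap.coe_mk, AddHom.coe_mk, Finsupp.support_filter, Finset.coe_filter,
    Set.mem_ofPred_eq] at ht
  exact ⟨hc ht.1, ht.2⟩

lemma sub_prj_mem {F : Set (Finset V)} (v : V) {j : ℕ} {c : AA V j} (hc : c ∈ SS F j) :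
    c - prj v j c ∈ SS (F ∩ {s | v ∉ s}) j := by
  have : c - prj v j c = Finsupp.filter (fun t => ¬ v ∈ Finset.univ.image t) c := by
    rw [sub_eq_iff_eq_add, add_comm]
    exact (Finsupp.filter_add_filter_not c _).symm
  rw [this]
  rw [SS, Finsupp.mem_supported] at *
  intro t ht
  simp only [Finsupp.support_filter, Finset.coe_filter, Set.mem_ofPred_eq] at ht
  exact ⟨hc ht.1, ht.2⟩

def ZZ (F : Set (Finset V)) : (j : ℕ) → Submodule ℚ (AA V j)
  | 0 => SS F 0
  | j + 1 => SS F (j + 1) ⊓ LinearMap.ker (dd j)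

def BB (F : Set (Finset V)) (j : ℕ) : Submodule ℚ (AA V j) := (SS F (j + 1)).map (dd j)

lemma BB_le_ZZ {F : Set (Finset V)} (hF : ∀ s ∈ F, ∀ t ⊆ s, t ∈ F) (j : ℕ) : BB F j ≤ ZZ F j := by
  rintro _ ⟨c, hc, rfl⟩
  cases j with
  | zero => exact dd_mem hF hc
  | succ j => exact ⟨dd_mem hF hc, dd_dd j c⟩

lemma fd_aux {E F : Type u} [AddCommGroup E] [Module ℚ E] [AddCommGroup F] [Module ℚ F]
    [FiniteDimensional ℚ E] (f : E →ₗ[ℚ] F) (Z : Submodule ℚ E) :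
    finrank ℚ (Z.map f) + finrank ℚ (Z ⊓ LinearMap.ker f : Submodule ℚ E) = finrank ℚ Z := by
  have h := LinearMap.finrank_range_add_finrank_ker (f.domRestrict Z)
  rw [LinearMap.range_domRestrict] at h
  rw [← h]
  rw [← Submodule.finrank_map_subtype_eq Z (LinearMap.ker (f.domRestrict Z)),
    LinearMap.ker_domRestrict, Submodule.map_comap_subtype]

lemma dim_aux {E F : Type u} [AddCommGroup E] [Module ℚ E] [AddCommGroup F] [Module ℚ F]
    [FiniteDimensional ℚ E] [FiniteDimensional ℚ F] (f : E →ₗ[ℚ] F) (Z : Submodule ℚ E)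
    (Z2 B2 : Submodule ℚ F) (hB : B2 ≤ Z2) (hZ : Z.map f ≤ Z2) :
    finrank ℚ Z + finrank ℚ B2 ≤ finrank ℚ Z2 + finrank ℚ (Z ⊓ B2.comap f : Submodule ℚ E) := by
  have h1 := fd_aux f Z
  have h2 := fd_aux f (Z ⊓ B2.comap f)
  have h3 : (Z ⊓ B2.comap f).map f = Z.map f ⊓ B2 := by
    ext y
    constructor
    · rintro ⟨x, ⟨hx, hb⟩, rfl⟩
      exact ⟨⟨x, hx, rfl⟩, hb⟩
    · rintro ⟨⟨x, hx, rfl⟩, hb⟩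
      exact ⟨x, ⟨hx, hb⟩, rfl⟩
  have h4 : Z ⊓ B2.comap f ⊓ LinearMap.ker f = Z ⊓ LinearMap.ker f := by
    apply le_antisymm
    · exact inf_le_inf_right _ inf_le_left
    · rintro x ⟨hx, hk⟩
      refine ⟨⟨hx, ?_⟩, hk⟩
      have : f x = 0 := hk
      simp [this]
  rw [h3, h4] at h2
  have h5 := Submodule.finrank_sup_add_finrank_inf_eq (Z.map f) B2
  have h6 := Submodule.finrank_mono (sup_le hZ hB)
  omega

variable [Fintype V]

lemma main_step (K : Set (Finset V)) (hK : ∀ s ∈ K, ∀ t ⊆ s, t ∈ K) (v : V)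
    (D L : Set (Finset V)) (hD : ∀ s, s ∈ D ↔ s ∈ K ∧ v ∉ s)
    (hL : ∀ s, s ∈ L ↔ insert v s ∈ K ∧ v ∉ s) (j : ℕ) :
    finrank ℚ (ZZ K (j + 1)) + finrank ℚ (BB D (j + 1)) + finrank ℚ (BB L j) ≤
      finrank ℚ (ZZ D (j + 1)) + finrank ℚ (ZZ L j) + finrank ℚ (BB K (j + 1)) := by
  have hDd : ∀ s ∈ D, ∀ t ⊆ s, t ∈ D := by
    intro s hs t hts
    rw [hD] at *
    exact ⟨hK s hs.1 t hts, fun h => hs.2 (hts h)⟩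
  have hLd : ∀ s ∈ L, ∀ t ⊆ s, t ∈ L := by
    intro s hs t hts
    rw [hL] at *
    exact ⟨hK _ hs.1 _ (Finset.insert_subset_insert _ hts), fun h => hs.2 (hts h)⟩
  have hDK : D ⊆ K := fun s hs => ((hD s).1 hs).1
  let St : Set (Finset V) := {s | insert v s ∈ K}
  have hSt : ∀ s ∈ St, ∀ t ⊆ s, t ∈ St := fun s hs t hts =>
    hK _ hs _ (Finset.insert_subset_insert _ hts)
  have hLeq : L = St ∩ {s | v ∉ s} := by ext s; exact hL s
  have hDeq : D = K ∩ {s | v ∉ s} := by ext s; exact hD s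
  have hprj : ∀ {m : ℕ} {c : AA V m}, c ∈ SS K m → prj v m c ∈ SS St m := by
    intro m c hc
    refine SS_mono ?_ m (prj_mem v hc)
    rintro s ⟨hs, hv⟩
    change insert v s ∈ K
    rw [Finset.insert_eq_of_mem hv]; exact hs
  let f : AA V (j + 1) →ₗ[ℚ] AA V j := (dd j).comp (prj v (j + 1))
  have hf : (ZZ K (j + 1)).map f ≤ ZZ L j := by
    rintro _ ⟨z, ⟨hz, hdz⟩, rfl⟩
    have hdz' : dd j z = 0 := hdz
    have h1 : f z ∈ SS St j := dd_mem hSt (hprj hz)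
    have h2 : f z = - dd j (z - prj v (j + 1) z) := by
      simp [f, hdz']
    have h3 : f z ∈ SS {s | v ∉ s} j := by
      rw [h2]
      refine Submodule.neg_mem _ (dd_mem ?_ (SS_mono (Set.inter_subset_right) _ (sub_prj_mem v hz)))
      intro s hs t hts h
      exact hs (hts h)
    have h4 : f z ∈ SS L j := by rw [hLeq]; exact SS_inter h1 h3
    cases j with
    | zero => exact h4
    | succ j => exact ⟨h4, dd_dd j _⟩
  have e1 := dim_aux f (ZZ K (j + 1)) (ZZ L j) (BB L j) (BB_le_ZZ hLd j) hf
  have e2 : ZZ K (j + 1) ⊓ (BB L j).comap f ≤ BB K (j + 1) ⊔ ZZ D (j + 1) := by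
    rintro z ⟨⟨hz, hdz⟩, w, hw, hwz⟩
    have hdz' : dd j z = 0 := hdz
    have hwz' : dd j w = dd j (prj v (j + 1) z) := hwz
    have hb : prj v (j + 1) z - w ∈ SS St (j + 1) :=
      Submodule.sub_mem _ (hprj hz) (SS_mono (by rw [hLeq]; exact Set.inter_subset_left) _ hw)
    have hdb : dd j (prj v (j + 1) z - w) = 0 := by rw [map_sub, hwz', sub_self]
    have hz' : z = (prj v (j + 1) z - w) + (z - prj v (j + 1) z + w) := by abel
    rw [hz']
    refine Submodule.add_mem_sup ?_ ⟨?_, ?_⟩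
    · refine ⟨pre v (j + 1) (prj v (j + 1) z - w), pre_mem v (fun s hs => hs) hb, ?_⟩
      rw [dd_pre, hdb]; simp
    · refine Submodule.add_mem _ ?_ (SS_mono ?_ _ hw)
      · rw [hDeq]; exact sub_prj_mem v hz
      · intro s hs
        rw [hL] at hs
        rw [hD]
        exact ⟨hK _ hs.1 _ (Finset.subset_insert _ _), hs.2⟩
    · change dd j _ = 0
      rw [map_add, map_sub, hdz', hwz']; simp
  have e3 := Submodule.finrank_mono e2
  have e4 := Submodule.finrank_sup_add_finrank_inf_eq (BB K (j + 1)) (ZZ D (j + 1))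
  have e5 : BB D (j + 1) ≤ BB K (j + 1) ⊓ ZZ D (j + 1) :=
    le_inf (Submodule.map_mono (SS_mono hDK _)) (BB_le_ZZ hDd _)
  have e6 := Submodule.finrank_mono e5
  omega

end HomAux
namespace HomAux

open SComplex

section incs

variable {V : Type u}

def inc (K : SComplex V) (j : ℕ) : Chain K j →ₗ[ℚ] AA V j :=
  Finsupp.lmapDomain ℚ ℚ (fun s : OSimplex K j => s.1)

lemma inc_inj (K : SComplex V) (j : ℕ) : Function.Injective (inc K j) :=
  Finsupp.mapDomain_injective (fun _ _ h => Subtype.ext h)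

lemma inc_top (K : SComplex V) (j : ℕ) : (⊤ : Submodule ℚ (Chain K j)).map (inc K j) =
    SS K.faces j := by
  rw [← Finsupp.supported_univ, inc, Finsupp.lmapDomain_supported, SS]
  congr 1
  ext t
  constructor
  · rintro ⟨s, -, rfl⟩
    exact s.2
  · intro ht
    exact ⟨⟨t, ht⟩, trivial, rfl⟩

lemma inc_bdry (K : SComplex V) (j : ℕ) (c : Chain K (j + 1)) :
    inc K j (bdry K j c) = dd j (inc K (j + 1) c) := by
  have : (inc K j).comp (bdry K j) = (dd j).comp (inc K (j + 1)) := by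
    refine Finsupp.lhom_ext' fun t => LinearMap.ext_ring ?_
    simp only [LinearMap.comp_apply, Finsupp.lsingle_apply, bdry, bdryO, inc, dd, dO,
      Finsupp.lmapDomain_apply, Finsupp.lsum_single, Finsupp.mapDomain_single,
      LinearMap.toSpanSingleton_apply, one_smul, Finsupp.mapDomain_finsetSum]
    exact Finset.sum_congr rfl fun i _ => Finsupp.mapDomain_single
  exact LinearMap.congr_fun this c

lemma inc_cycles (K : SComplex V) (j : ℕ) : (cyclesAt K j).map (inc K j) = ZZ K.faces j := by
  cases j with
  | zero => exact inc_top K 0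
  | succ j =>
    simp only [ZZ, cyclesAt]
    rw [← inc_top]
    ext y
    constructor
    · rintro ⟨x, hx, rfl⟩
      have hx' : bdry K j x = 0 := hx
      refine ⟨⟨x, trivial, rfl⟩, ?_⟩
      change dd j _ = 0
      rw [← inc_bdry, hx', map_zero]
    · rintro ⟨⟨x, -, rfl⟩, hx⟩
      have hx' : dd j (inc K (j + 1) x) = 0 := hx
      refine ⟨x, ?_, rfl⟩
      change bdry K j x = 0
      rw [← inc_bdry] at hx'
      exact inc_inj K j (by rw [hx', map_zero])

lemma inc_bds (K : SComplex V) (j : ℕ) : (boundariesAt K j).map (inc K j) = BB K.faces j := by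
  rw [boundariesAt, BB, ← inc_top, LinearMap.range_eq_map, ← Submodule.map_comp,
    ← Submodule.map_comp]
  congr 1
  ext1 c
  exact LinearMap.ext_ring (by simpa using inc_bdry K j _)

lemma bds_le (K : SComplex V) (j : ℕ) : boundariesAt K j ≤ cyclesAt K j := by
  have := BB_le_ZZ (fun s hs t hts => K.down_closed hs hts) j (F := K.faces)
  rw [← inc_bds, ← inc_cycles] at this
  exact (Submodule.map_le_map_iff_of_injective (inc_inj K j) _ _).1 this

end incs

variable {V : Type u} [Fintype V]

instance (K : SComplex V) (j : ℕ) : Finite (OSimplex K j) := Subtype.finite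

lemma betti_eq (K : SComplex V) (j : ℕ) :
    bettiAt K j + finrank ℚ (BB K.faces j) = finrank ℚ (ZZ K.faces j) := by
  rw [← inc_bds, ← inc_cycles,
    ← (Submodule.equivMapOfInjective (inc K j) (inc_inj K j) _).finrank_eq,
    ← (Submodule.equivMapOfInjective (inc K j) (inc_inj K j) _).finrank_eq,
    ← (Submodule.comapSubtypeEquivOfLe (bds_le K j)).finrank_eq]
  exact Submodule.finrank_quotient_add_finrank _

lemma finrank_ds (H : ℕ → Type u) [∀ j, AddCommGroup (H j)] [∀ j, Module ℚ (H j)]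
    [∀ j, Module.Finite ℚ (H j)] (N : ℕ) (hs : ∀ j, N ≤ j → Subsingleton (H j)) :
    finrank ℚ (⨁ j : ℕ, H j) = ∑ j ∈ Finset.range N, finrank ℚ (H j) := by
  let f : (⨁ j : ℕ, H j) →ₗ[ℚ] ((i : Fin N) → H i) :=
    LinearMap.pi fun i => DirectSum.component ℚ ℕ H i
  have hf : Function.Bijective f := by
    constructor
    · intro x y hx
      refine DFinsupp.ext fun j => ?_
      by_cases hj : j < N
      · exact congrFun hx ⟨j, hj⟩
      · have := hs j (by omega)
        exact Subsingleton.elim _ _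
    · intro y
      refine ⟨∑ i : Fin N, DirectSum.lof ℚ ℕ H i (y i), ?_⟩
      ext1 i
      rw [map_sum, Finset.sum_apply, Finset.sum_eq_single i]
      · exact DirectSum.component.lof_self (ι := ℕ) (M := H) ℚ _ (y i)
      · intro b _ hb
        have : (b : ℕ) ≠ i := fun h => hb (Fin.ext h)
        exact (DirectSum.component.of (ι := ℕ) (M := H) ℚ _ _ _).trans (dif_neg this)
      · simp
  rw [(LinearEquiv.ofBijective f hf).finrank_eq, Module.finrank_pi_fintype,
    Finset.sum_range]

lemma total_eq (K : SComplex V) (N : ℕ) (h : ∀ j, N ≤ j → bettiAt K j = 0) :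
    totalBetti K = ∑ j ∈ Finset.range N, bettiAt K j := by
  have hs : ∀ j, N ≤ j → Subsingleton (homologyAt K j) := fun j hj =>
    Module.finrank_zero_iff.1 (h j hj)
  exact finrank_ds (homologyAt K) N hs

def del (K : SComplex V) (v : V) : SComplex V := inducedSub K {v}ᶜ
def lnk (K : SComplex V) (v : V) (hv : {v} ∈ K.faces) : SComplex V := lkW K {v} {v} hv

lemma mem_del (K : SComplex V) (v : V) (s : Finset V) :
    s ∈ (del K v).faces ↔ s ∈ K.faces ∧ v ∉ s := by
  change (s ∈ K.faces ∧ ∀ w ∈ s, w ∈ ({v}ᶜ : Set V)) ↔ _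
  refine and_congr_right fun _ => ⟨fun h hv => h v hv rfl, fun h w hw hwv => ?_⟩
  rw [Set.mem_singleton_iff] at hwv
  exact h (hwv ▸ hw)

lemma mem_lnk (K : SComplex V) (v : V) (hv : {v} ∈ K.faces) (s : Finset V) :
    s ∈ (lnk K v hv).faces ↔ insert v s ∈ K.faces ∧ v ∉ s := by
  change ((∀ w ∈ s, w ∉ ({v} : Set V)) ∧ s ∪ {v} ∈ K.faces) ↔ _
  rw [and_comm]
  refine and_congr ?_ ⟨fun h hv => h v hv rfl, fun h w hw hwv => ?_⟩
  · rw [Finset.union_comm, Finset.insert_eq]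
  · rw [Set.mem_singleton_iff] at hwv
    exact h (hwv ▸ hw)

lemma betti_succ (K : SComplex V) (v : V) (hv : {v} ∈ K.faces) (j : ℕ) :
    bettiAt K (j + 1) ≤ bettiAt (del K v) (j + 1) + bettiAt (lnk K v hv) j := by
  have := main_step K.faces (fun s hs t hts => K.down_closed hs hts) v (del K v).faces
    (lnk K v hv).faces (mem_del K v) (mem_lnk K v hv) j
  have h1 := betti_eq K (j + 1)
  have h2 := betti_eq (del K v) (j + 1)
  have h3 := betti_eq (lnk K v hv) j
  omega

lemma betti_zero (K : SComplex V) (v : V) : bettiAt K 0 ≤ bettiAt (del K v) 0 := by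
  have h1 := betti_eq K 0
  have h2 := betti_eq (del K v) 0
  have h3 : ZZ K.faces 0 = ZZ (del K v).faces 0 := by
    simp only [ZZ, SS]
    congr 1
    ext t
    have : Finset.univ.image t = ∅ := by simp
    simp only [Set.mem_ofPred_eq]
    rw [this]
    exact ⟨fun _ => SComplex.empty_mem _, fun _ => SComplex.empty_mem _⟩
  have h4 : BB (del K v).faces 0 ≤ BB K.faces 0 :=
    Submodule.map_mono (SS_mono (fun s hs => ((mem_del K v s).1 hs).1) _)
  have h5 := Submodule.finrank_mono h4
  rw [h3] at h1
  omega

lemma sc_ext {K L : SComplex V} (h : ∀ s, s ∈ K.faces ↔ s ∈ L.faces) : K = L := by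
  cases K; cases L
  congr
  exact Set.ext h

lemma del_eq (K : SComplex V) (v : V) (hv : {v} ∉ K.faces) : del K v = K := by
  refine sc_ext fun s => ?_
  rw [mem_del]
  refine ⟨fun h => h.1, fun h => ⟨h, fun hvs => hv (K.down_closed h ?_)⟩⟩
  simpa using hvs

lemma vanish_aux (U : Finset V) : ∀ K : SComplex V, (∀ s ∈ K.faces, s ⊆ U) →
    ∃ N, ∀ j, N ≤ j → bettiAt K j = 0 := by
  induction U using Finset.induction_on with
  | empty =>
    intro K hK
    refine ⟨1, fun j hj => ?_⟩
    obtain ⟨j, rfl⟩ : ∃ i, j = i + 1 := ⟨j - 1, by omega⟩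
    have : IsEmpty (OSimplex K (j + 1)) := by
      refine ⟨fun s => ?_⟩
      have h1 := hK _ s.2
      have h2 : s.1 0 ∈ Finset.univ.image s.1 := Finset.mem_image_of_mem _ (Finset.mem_univ _)
      simpa using h1 h2
    exact Module.finrank_zero_of_subsingleton
  | insert v U hvU ih =>
    intro K hK
    have hd : ∀ s ∈ (del K v).faces, s ⊆ U := by
      intro s hs
      rw [mem_del] at hs
      intro w hw
      have := hK s hs.1 hw
      rw [Finset.mem_insert] at this
      rcases this with rfl | h
      · exact absurd hw hs.2
      · exact h
    by_cases hv : {v} ∈ K.faces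
    · have hl : ∀ s ∈ (lnk K v hv).faces, s ⊆ U := by
        intro s hs
        rw [mem_lnk] at hs
        intro w hw
        have := hK _ hs.1 (Finset.mem_insert_of_mem hw)
        rw [Finset.mem_insert] at this
        rcases this with rfl | h
        · exact absurd hw hs.2
        · exact h
      obtain ⟨N1, h1⟩ := ih _ hd
      obtain ⟨N2, h2⟩ := ih _ hl
      refine ⟨N1 + N2 + 1, fun j hj => ?_⟩
      obtain ⟨j, rfl⟩ : ∃ i, j = i + 1 := ⟨j - 1, by omega⟩
      have := betti_succ K v hv j
      have := h1 (j + 1) (by omega)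
      have := h2 j (by omega)
      omega
    · rw [del_eq K v hv] at hd
      exact ih _ hd

lemma total_le (K : SComplex V) (v : V) (hv : {v} ∈ K.faces) :
    totalBetti K ≤ totalBetti (del K v) + totalBetti (lnk K v hv) := by
  obtain ⟨N0, h0⟩ := vanish_aux Finset.univ K (fun s _ => Finset.subset_univ s)
  obtain ⟨N1, h1⟩ := vanish_aux Finset.univ (del K v) (fun s _ => Finset.subset_univ s)
  obtain ⟨N2, h2⟩ := vanish_aux Finset.univ (lnk K v hv) (fun s _ => Finset.subset_univ s)
  rw [total_eq K (N0 + N1 + N2 + 1) (fun j hj => h0 j (by omega)),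
    total_eq (del K v) (N0 + N1 + N2 + 1) (fun j hj => h1 j (by omega)),
    total_eq (lnk K v hv) (N0 + N1 + N2) (fun j hj => h2 j (by omega)),
    Finset.sum_range_succ', Finset.sum_range_succ' (fun j => bettiAt (del K v) j)]
  have e1 := betti_zero K v
  have e2 := Finset.sum_le_sum fun j (_ : j ∈ Finset.range (N0 + N1 + N2)) => betti_succ K v hv j
  rw [Finset.sum_add_distrib] at e2
  omega

lemma mem_lkW (K : SComplex V) (U : Set V) (σ : Finset V) (hσ : σ ∈ K.faces) (s : Finset V) :
    s ∈ (lkW K U σ hσ).faces ↔ (∀ v ∈ s, v ∉ U) ∧ s ∪ σ ∈ K.faces := Iff.rfl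

lemma general (U : Finset V) (B : ℕ) : ∀ K : SComplex V,
    (∀ σ, (hσ : σ ∈ K.faces) → σ ⊆ U → totalBetti (lkW K (U : Set V) σ hσ) ≤ B) →
    totalBetti K ≤ B * (facesIn K (U : Set V)).ncard := by
  induction U using Finset.induction_on with
  | empty =>
    intro K hK
    have h1 : facesIn K ((∅ : Finset V) : Set V) = {∅} := by
      ext s
      constructor
      · rintro ⟨-, h⟩
        refine Finset.eq_empty_of_forall_notMem fun v hv => ?_
        simpa using h v hv
      · rintro rfl
        exact ⟨K.empty_mem, by simp⟩
    have h2 : lkW K ((∅ : Finset V) : Set V) ∅ K.empty_mem = K :=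
      sc_ext fun s => by rw [mem_lkW]; simp
    have := hK ∅ K.empty_mem (by simp)
    rw [h2] at this
    rw [h1, Set.ncard_singleton, mul_one]
    exact this
  | insert v U hvU ih =>
    intro K hK
    have hd : totalBetti (del K v) ≤ B * (facesIn (del K v) (U : Set V)).ncard := by
      refine ih _ fun σ hσ hσU => ?_
      have hσ' := (mem_del K v σ).1 hσ
      have e : lkW (del K v) (U : Set V) σ hσ =
          lkW K ((insert v U : Finset V) : Set V) σ hσ'.1 := by
        refine sc_ext fun s => ?_
        rw [mem_lkW, mem_lkW, mem_del]
        have := hσ'.2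
        simp only [Finset.mem_union, Finset.coe_insert, Set.mem_insert_iff, Finset.mem_coe]
        grind
      rw [e]
      exact hK _ _ (hσU.trans (Finset.subset_insert _ _))
    by_cases hv : {v} ∈ K.faces
    · have hl : totalBetti (lnk K v hv) ≤ B * (facesIn (lnk K v hv) (U : Set V)).ncard := by
        refine ih _ fun σ hσ hσU => ?_
        have hσ' := (mem_lnk K v hv σ).1 hσ
        have e : lkW (lnk K v hv) (U : Set V) σ hσ =
            lkW K ((insert v U : Finset V) : Set V) (insert v σ) hσ'.1 := by
          refine sc_ext fun s => ?_
          rw [mem_lkW, mem_lkW, mem_lnk, Finset.union_insert]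
          have := hσ'.2
          simp only [Finset.mem_union, Finset.coe_insert, Set.mem_insert_iff, Finset.mem_coe]
          grind
        rw [e]
        exact hK _ _ (Finset.insert_subset_insert _ hσU)
      have hc : (facesIn (del K v) (U : Set V)).ncard + (facesIn (lnk K v hv) (U : Set V)).ncard ≤
          (facesIn K ((insert v U : Finset V) : Set V)).ncard := by
        have hinj : Set.InjOn (fun s => insert v s) (facesIn (lnk K v hv) (U : Set V)) := by
          intro s hs t ht hst
          have h1 := ((mem_lnk K v hv s).1 hs.1).2
          have h2 := ((mem_lnk K v hv t).1 ht.1).2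
          have := congrArg (fun x => Finset.erase x v) hst
          simpa [h1, h2] using this
        rw [← Set.InjOn.ncard_image hinj, ← Set.ncard_union_eq ?_ (Set.toFinite _) (Set.toFinite _)]
        · refine Set.ncard_le_ncard ?_ (Set.toFinite _)
          rintro s (hs | ⟨t, ht, rfl⟩)
          · exact ⟨((mem_del K v s).1 hs.1).1, fun w hw => by
              rw [Finset.coe_insert]; exact Or.inr (hs.2 w hw)⟩
          · refine ⟨((mem_lnk K v hv t).1 ht.1).1, fun w hw => ?_⟩
            rw [Finset.coe_insert]
            rcases Finset.mem_insert.1 hw with h | h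
            · exact Or.inl h
            · exact Or.inr (ht.2 w h)
        · rw [Set.disjoint_left]
          rintro s hs ⟨t, ht, rfl⟩
          exact ((mem_del K v _).1 hs.1).2 (Finset.mem_insert_self _ _)
      calc totalBetti K ≤ _ := total_le K v hv
        _ ≤ _ := add_le_add hd hl
        _ = _ := (mul_add _ _ _).symm
        _ ≤ _ := Nat.mul_le_mul_left _ hc
    · rw [del_eq K v hv] at hd
      refine hd.trans (Nat.mul_le_mul_left _ (Set.ncard_le_ncard ?_ (Set.toFinite _)))
      exact fun s hs => ⟨hs.1, fun w hw => by rw [Finset.coe_insert]; exact Or.inr (hs.2 w hw)⟩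

end HomAux
/-- Let `G` be a finite simple graph and `U ⊆ V(G)` such that for every
independent set `σ` of `G[U]` (including `σ = ∅`) the total Betti number of
`I(G \ (U ∪ N[σ]))` is at most `B`.  Then `β̃(I(G)) ≤ B · |I(G[U])| ≤ B · 2^{|U|}`.
Moreover, for the vertex partition of `I(G)` into `U` and `W = V(G) \ U` one has
`lk_W σ = I(G \ (U ∪ N[σ]))` for every face `σ` of `I(G[U])`.
(Here `I(G \ S)` is realized as the induced subcomplex of `I(G)` on `Sᶜ`, and
`|I(G[U])|` is the number of independent sets of `G[U]`, the empty one included.) -/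
theorem statement15 {V : Type} [Fintype V] (G : SimpleGraph V) (U : Set V) (B : ℕ)
    (h : ∀ σ : Finset V, σ ∈ (indepComplex G).faces → (∀ v ∈ σ, v ∈ U) →
      SComplex.totalBetti (inducedSub (indepComplex G) ((U ∪ closedNbhd G σ)ᶜ)) ≤ B) :
    SComplex.totalBetti (indepComplex G) ≤
        B * (SComplex.facesIn (indepComplex G) U).ncard ∧
    B * (SComplex.facesIn (indepComplex G) U).ncard ≤ B * 2 ^ U.ncard ∧
    ∀ σ : Finset V, (hσ : σ ∈ (indepComplex G).faces) → (∀ v ∈ σ, v ∈ U) →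
      (SComplex.lkW (indepComplex G) U σ hσ).faces =
        (inducedSub (indepComplex G) ((U ∪ closedNbhd G σ)ᶜ)).faces := by
  classical
  have hlk : ∀ σ : Finset V, (hσ : σ ∈ (indepComplex G).faces) → (∀ v ∈ σ, v ∈ U) →
      (SComplex.lkW (indepComplex G) U σ hσ).faces =
        (inducedSub (indepComplex G) ((U ∪ closedNbhd G σ)ᶜ)).faces := by
    intro σ hσ hσU
    ext s
    rw [HomAux.mem_lkW]
    constructor
    · rintro ⟨h1, h2⟩
      refine ⟨(indepComplex G).down_closed h2 Finset.subset_union_left, fun v hv hv' => ?_⟩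
      rcases hv' with hv' | ⟨w, hw, rfl | hadj⟩
      · exact h1 v hv hv'
      · exact h1 _ hv (hσU _ hw)
      · exact h2 w (Finset.mem_union_right _ hw) v (Finset.mem_union_left _ hv) hadj
    · rintro ⟨h1, h2⟩
      refine ⟨fun v hv hvU => h2 v hv (Or.inl hvU), fun v hv w hw hadj => ?_⟩
      rcases Finset.mem_union.1 hv with hv | hv <;> rcases Finset.mem_union.1 hw with hw | hw
      · exact h1 v hv w hw hadj
      · exact h2 v hv (Or.inr ⟨w, hw, Or.inr hadj.symm⟩)
      · exact h2 w hw (Or.inr ⟨v, hv, Or.inr hadj⟩)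
      · exact hσ v hv w hw hadj
  refine ⟨?_, ?_, hlk⟩
  · have := HomAux.general U.toFinset B (indepComplex G) ?_
    · rwa [Set.coe_toFinset] at this
    · intro σ hσ hσU
      have hσU' : ∀ v ∈ σ, v ∈ U := fun v hv => Set.mem_toFinset.1 (hσU hv)
      have e : SComplex.lkW (indepComplex G) (U.toFinset : Set V) σ hσ =
          inducedSub (indepComplex G) ((U ∪ closedNbhd G σ)ᶜ) := by
        refine HomAux.sc_ext fun s => ?_
        rw [← hlk σ hσ hσU', HomAux.mem_lkW, HomAux.mem_lkW, Set.coe_toFinset]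
      rw [e]
      exact h σ hσ hσU'
  · refine Nat.mul_le_mul_left _ ?_
    have hsub : SComplex.facesIn (indepComplex G) U ⊆ (U.toFinset.powerset : Set (Finset V)) := by
      intro s hs
      rw [Finset.mem_coe, Finset.mem_powerset]
      exact fun v hv => Set.mem_toFinset.2 (hs.2 v hv)
    refine (Set.ncard_le_ncard hsub (Set.toFinite _)).trans ?_
    rw [Set.ncard_coe_finset, Finset.card_powerset, Set.ncard_eq_toFinset_card']
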